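/- arXiv:1907.06278 — 2 statements merged into one kernel-verified Lean document; each statement's English description precedes it below -/
import Mathlib

section
/- The periodic heat semigroup P_t satisfies the Schauder estimate: for α ∈ ℝ, β ∈ [0,2), p ∈ [1,∞] and T > 0, sup_{0 ≤ t ≤ T} t^{β/2} ‖P_t f‖_{B^{α+β}_{p,∞}(𝕋^d)} ≲ ‖f‖_{B^α_{p,∞}(𝕋^d)}. -/
noncomputable section
open MeasureTheory Filter

/-- The `d`-dimensional torus. -/
abbrev TorusD (d : ℕ) := Fin d → AddCircle (1 : ℝ)

/-- The character `e_k(y) = ∏ᵢ e^{2πi kᵢ yᵢ}` on the `d`-dimensional torus. -/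
def charD {d : ℕ} (k : Fin d → ℤ) : TorusD d → ℂ :=
  fun y => ∏ i, fourier (k i) (y i)

/-- The function with Fourier coefficients `c`. -/
def fourierSeries {d : ℕ} (c : (Fin d → ℤ) → ℂ) : TorusD d → ℂ :=
  fun y => ∑' k : Fin d → ℤ, c k * charD k y

/-- Euclidean norm of a frequency. -/
def freqNorm {d : ℕ} (k : Fin d → ℤ) : ℝ := Real.sqrt (∑ i, ((k i : ℝ)) ^ 2)

/-- Multiplier of the `j`-th Littlewood–Paley block from a dyadic partition of
unity `(χ, ρ)`: `χ` for `j = -1`, `ρ(·/2^j)` for `j ≥ 0`. -/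
def lpMult (χ ρ : ℝ → ℝ) (j : ℤ) (ξ : ℝ) : ℝ :=
  if j = -1 then χ ξ else ρ (ξ / (2 : ℝ) ^ j)

/-- The `j`-th Littlewood–Paley block of the function with coefficients `c`. -/
def lpBlock {d : ℕ} (χ ρ : ℝ → ℝ) (j : ℤ) (c : (Fin d → ℤ) → ℂ) :
    TorusD d → ℂ :=
  fourierSeries (fun k => ((lpMult χ ρ j (freqNorm k) : ℝ) : ℂ) * c k)

/-- The Besov `B^α_{p,∞}` norm of the function with coefficients `c`:
`sup_{j ≥ -1} 2^{jα} ‖Δ_j f‖_{L^p}`. -/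
def besovNorm {d : ℕ} (χ ρ : ℝ → ℝ) (α : ℝ) (p : ENNReal)
    (c : (Fin d → ℤ) → ℂ) : ENNReal :=
  ⨆ j : ℤ, ⨆ _ : -1 ≤ j, ENNReal.ofReal (Real.rpow 2 (α * (j : ℝ))) *
    eLpNorm (lpBlock χ ρ j c) p volume

/-- Fourier coefficients of the heat semigroup `P_t f = e^{tΔ} f`:
`(P_t f)^(k) = e^{-4π²|k|²t} f^(k)`. -/
def heatCoef {d : ℕ} (t : ℝ) (c : (Fin d → ℤ) → ℂ) : (Fin d → ℤ) → ℂ :=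
  fun k => Complex.exp (-(4 * Real.pi ^ 2 * (freqNorm k) ^ 2 * t)) * c k


namespace Schauder

lemma continuous_charD {d : ℕ} (k : Fin d → ℤ) : Continuous (charD k) := by
  unfold charD
  fun_prop

lemma fs_eq {d : ℕ} (S : Finset (Fin d → ℤ)) (c : (Fin d → ℤ) → ℂ) (hc : ∀ k, k ∉ S → c k = 0) :
    fourierSeries c = fun y => ∑ k ∈ S, c k * charD k y := by
  funext y
  unfold fourierSeries
  exact tsum_eq_sum (fun k hk => by rw [hc k hk, zero_mul])

lemma fs_cont {d : ℕ} (S : Finset (Fin d → ℤ)) (c : (Fin d → ℤ) → ℂ)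
    (hc : ∀ k, k ∉ S → c k = 0) : Continuous (fourierSeries c) := by
  rw [fs_eq S c hc]
  have := fun k : Fin d → ℤ => continuous_charD k
  fun_prop

/-- `m` is a Fourier multiplier with norm at most `A` on functions with spectrum in `S`. -/
def MB {d : ℕ} (p : ENNReal) (S : Finset (Fin d → ℤ)) (m : (Fin d → ℤ) → ℂ) (A : ℝ) : Prop :=
  0 ≤ A ∧ ∀ c : (Fin d → ℤ) → ℂ, (∀ k, k ∉ S → c k = 0) →
    eLpNorm (fourierSeries fun k => m k * c k) p volume ≤
      ENNReal.ofReal A * eLpNorm (fourierSeries c) p volume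

variable {d : ℕ} {p : ENNReal} {S : Finset (Fin d → ℤ)}

lemma MB.one : MB p S (fun _ => 1) 1 := by
  refine ⟨zero_le_one, fun c _ => ?_⟩
  simp

lemma MB.congr {m m' : (Fin d → ℤ) → ℂ} {A : ℝ} (h : MB p S m A) (e : ∀ k ∈ S, m' k = m k) :
    MB p S m' A := by
  refine ⟨h.1, fun c hc => ?_⟩
  have : (fun k => m' k * c k) = fun k => m k * c k := by
    funext k
    by_cases hk : k ∈ S
    · rw [e k hk]
    · rw [hc k hk]; simp
  rw [this]
  exact h.2 c hc

lemma MB.mono {m : (Fin d → ℤ) → ℂ} {A B : ℝ} (h : MB p S m A) (e : A ≤ B) : MB p S m B := by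
  refine ⟨h.1.trans e, fun c hc => (h.2 c hc).trans ?_⟩
  gcongr

lemma MB.mul {m m' : (Fin d → ℤ) → ℂ} {A B : ℝ} (h : MB p S m A) (h' : MB p S m' B) :
    MB p S (fun k => m k * m' k) (A * B) := by
  refine ⟨mul_nonneg h.1 h'.1, fun c hc => ?_⟩
  have h1 := h.2 (fun k => m' k * c k) (fun k hk => by rw [hc k hk, mul_zero])
  have h2 := h'.2 c hc
  simp only [mul_assoc]
  refine h1.trans ?_
  rw [ENNReal.ofReal_mul h.1, mul_assoc]
  gcongr

lemma MB.add (hp : 1 ≤ p) {m m' : (Fin d → ℤ) → ℂ} {A B : ℝ} (h : MB p S m A)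
    (h' : MB p S m' B) : MB p S (fun k => m k + m' k) (A + B) := by
  refine ⟨add_nonneg h.1 h'.1, fun c hc => ?_⟩
  have h1 := h.2 c hc
  have h2 := h'.2 c hc
  have e1 : ∀ k, k ∉ S → m k * c k = 0 := fun k hk => by rw [hc k hk, mul_zero]
  have e2 : ∀ k, k ∉ S → m' k * c k = 0 := fun k hk => by rw [hc k hk, mul_zero]
  have e3 : ∀ k, k ∉ S → (m k + m' k) * c k = 0 := fun k hk => by rw [hc k hk, mul_zero]
  have : (fourierSeries fun k => (m k + m' k) * c k) =
      (fourierSeries fun k => m k * c k) + fourierSeries fun k => m' k * c k := by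
    rw [fs_eq S _ e1, fs_eq S _ e2, fs_eq S _ e3]
    funext y
    simp only [Pi.add_apply, ← Finset.sum_add_distrib]
    refine Finset.sum_congr rfl fun k _ => by ring
  rw [this, ENNReal.ofReal_add h.1 h'.1, add_mul]
  exact (eLpNorm_add_le (fs_cont S _ e1).aestronglyMeasurable
    (fs_cont S _ e2).aestronglyMeasurable hp).trans (add_le_add h1 h2)

lemma MB.smul {m : (Fin d → ℤ) → ℂ} {A : ℝ} (r : ℂ) (h : MB p S m A) :
    MB p S (fun k => r * m k) (‖r‖ * A) := by
  refine ⟨mul_nonneg (norm_nonneg _) h.1, fun c hc => ?_⟩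
  have : (fourierSeries fun k => r * m k * c k) = r • (fourierSeries fun k => m k * c k) := by
    funext y
    simp only [fourierSeries, Pi.smul_apply, smul_eq_mul, ← tsum_mul_left, mul_assoc]
  rw [this, eLpNorm_const_smul, ENNReal.ofReal_mul (norm_nonneg _), mul_assoc, ofReal_norm]
  gcongr
  exact h.2 c hc

lemma MB.sum (hp : 1 ≤ p) {ι : Type*} (s : Finset ι) {m : ι → (Fin d → ℤ) → ℂ} {A : ι → ℝ}
    (h : ∀ i ∈ s, MB p S (m i) (A i)) : MB p S (fun k => ∑ i ∈ s, m i k) (∑ i ∈ s, A i) := by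
  classical
  induction s using Finset.induction_on with
  | empty =>
    simp only [Finset.sum_empty]
    refine ⟨le_rfl, fun c hc => ?_⟩
    have : (fourierSeries fun k => (0:ℂ) * c k) = 0 := by
      funext y; simp [fourierSeries]
    rw [this]; simp
  | insert a s ha ih =>
    simp only [Finset.sum_insert ha]
    exact MB.add hp (h a (by simp)) (ih fun i hi => h i (by simp [hi]))

lemma MB.prod {ι : Type*} (s : Finset ι) {m : ι → (Fin d → ℤ) → ℂ} {A : ι → ℝ}
    (h : ∀ i ∈ s, MB p S (m i) (A i)) : MB p S (fun k => ∏ i ∈ s, m i k) (∏ i ∈ s, A i) := by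
  classical
  induction s using Finset.induction_on with
  | empty => simpa using MB.one
  | insert a s ha ih =>
    simp only [Finset.prod_insert ha]
    exact MB.mul (h a (by simp)) (ih fun i hi => h i (by simp [hi]))

lemma charD_add_single (k : Fin d → ℤ) (y : TorusD d) (i : Fin d) (θ : AddCircle (1:ℝ)) :
    charD k (y + Pi.single i θ) = fourier (k i) θ * charD k y := by
  classical
  unfold charD
  have : ∀ l, (fourier (k l) ((y + Pi.single i θ : TorusD d) l) : ℂ) =
      fourier (k l) (y l) * (if l = i then fourier (k i) θ else 1) := by
    intro l
    by_cases h : l = i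
    · subst h
      simp [fourier_apply, smul_add, AddCircle.toCircle_add]
    · simp [h]
  simp only [this, Finset.prod_mul_distrib, Finset.prod_ite_eq', Finset.mem_univ, if_true]
  ring

lemma MB.trans (i : Fin d) (θ : AddCircle (1:ℝ)) :
    MB p S (fun k => fourier (k i) θ) 1 := by
  refine ⟨zero_le_one, fun c hc => ?_⟩
  have : (fourierSeries fun k => (fourier (k i) θ : ℂ) * c k) =
      fourierSeries c ∘ (fun y => y + Pi.single i θ) := by
    funext y
    simp only [fourierSeries, Function.comp, charD_add_single]
    refine tsum_congr fun k => by ring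
  rw [this, eLpNorm_comp_measurePreserving (fs_cont S c hc).aestronglyMeasurable
    (measurePreserving_add_right volume _)]
  simp

lemma count_fejer (N : ℕ) (k : ℤ) :
    (∑ a ∈ Finset.range N, ∑ b ∈ Finset.range N, if (a:ℤ) - b + k = 0 then (1:ℂ) else 0) =
      ((max ((N:ℝ) - |(k:ℝ)|) 0 : ℝ) : ℂ) := by
  have key : ∀ (n : ℕ), (∑ a ∈ Finset.range N, ∑ b ∈ Finset.range N,
      if (a:ℤ) + n = b then (1:ℂ) else 0) = ((N - n : ℕ) : ℂ) := by
    intro n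
    have : ∀ a ∈ Finset.range N, (∑ b ∈ Finset.range N, if (a:ℤ) + n = b then (1:ℂ) else 0) =
        if a < N - n then 1 else 0 := by
      intro a ha
      have : ∀ b : ℕ, ((a:ℤ) + n = b) ↔ a + n = b := fun b => by omega
      simp only [this, Finset.sum_ite_eq, Finset.mem_range]
      congr 1
      simp; omega
    rw [Finset.sum_congr rfl this, Finset.sum_ite]
    simp only [Finset.sum_const_zero, add_zero, Finset.sum_const, nsmul_eq_mul, mul_one]
    congr 1
    have : (Finset.range N).filter (fun a => a < N - n) = Finset.range (N - n) := by
      ext a; simp; omega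
    rw [this, Finset.card_range]
  have cast : ∀ n : ℕ, ((N - n : ℕ) : ℂ) = ((max ((N:ℝ) - n) 0 : ℝ) : ℂ) := by
    intro n
    rcases le_total n N with h | h
    · rw [max_eq_left (by simpa using h)]; push_cast [h]; ring
    · rw [max_eq_right (by simpa using h), Nat.sub_eq_zero_of_le h]; simp
  obtain ⟨n, rfl | rfl⟩ := Int.eq_nat_or_neg k
  · rw [Int.cast_natCast, Nat.abs_cast, ← cast, ← key]
    refine Finset.sum_congr rfl fun a _ => Finset.sum_congr rfl fun b _ => ?_
    congr 1; simp; omega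
  · rw [Int.cast_neg, abs_neg, Int.cast_natCast, Nat.abs_cast, ← cast, ← key, Finset.sum_comm]
    refine Finset.sum_congr rfl fun a _ => Finset.sum_congr rfl fun b _ => ?_
    congr 1; simp; omega

lemma root_sum (L : ℕ) (hL : 0 < L) (n : ℤ) (hn : |n| < L) :
    (∑ q ∈ Finset.range L, (fourier n (((q:ℝ) / L : ℝ) : AddCircle (1:ℝ)) : ℂ)) =
      if n = 0 then (L:ℂ) else 0 := by
  have hz := Complex.isPrimitiveRoot_exp L hL.ne'
  set ζ := Complex.exp (2 * Real.pi * Complex.I / L) with hζ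
  have e : ∀ q : ℕ, (fourier n (((q:ℝ) / L : ℝ) : AddCircle (1:ℝ)) : ℂ) = (ζ ^ n) ^ q := by
    intro q
    rw [fourier_coe_apply, hζ, ← Complex.exp_int_mul, ← Complex.exp_nat_mul]
    congr 1
    push_cast
    field_simp
  simp only [e]
  split_ifs with h
  · simp [h]
  · have h1 : ζ ^ n ≠ 1 := by
      intro h2
      have := (hz.zpow_eq_one_iff_dvd n).1 h2
      exact h (Int.eq_zero_of_abs_lt_dvd this hn)
    have h3 : (ζ ^ n) ^ L = 1 := by
      rw [← zpow_natCast, ← zpow_mul, mul_comm, zpow_mul, zpow_natCast, hz.pow_eq_one, one_zpow]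
    have := geom_sum_eq h1 L
    rw [this, h3]; simp

lemma MB.fejer (hp : 1 ≤ p) (i : Fin d) (N : ℕ) :
    MB p S (fun k => ((max ((N:ℝ) - |(k i : ℝ)|) 0 : ℝ) : ℂ)) N := by
  obtain ⟨B, hB⟩ : ∃ B : ℕ, ∀ k ∈ S, (k i).natAbs ≤ B :=
    ⟨S.sup fun k => (k i).natAbs, fun k hk => Finset.le_sup (f := fun k => (k i).natAbs) hk⟩
  set L := N + B + 1 with hLdef
  have hL : 0 < L := by omega
  have hLc : (L:ℂ) ≠ 0 := by exact_mod_cast hL.ne'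
  let θ : ℕ → AddCircle (1:ℝ) := fun q => (((q:ℝ) / L : ℝ) : AddCircle (1:ℝ))
  let D : ℕ → ℂ := fun q => ∑ a ∈ Finset.range N, (fourier (a:ℤ) (θ q) : ℂ)
  let w : ℕ → ℝ := fun q => (1 / L) * ‖D q‖ ^ 2
  have hw0 : ∀ q, 0 ≤ w q := fun q => by positivity
  have hD : ∀ q, ((w q : ℝ) : ℂ) = (1 / L) * ∑ a ∈ Finset.range N, ∑ b ∈ Finset.range N,
      (fourier ((a:ℤ) - b) (θ q) : ℂ) := by
    intro q
    simp only [w]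
    push_cast
    rw [← Complex.mul_conj']
    congr 1
    simp only [D, map_sum, Finset.sum_mul_sum, ← fourier_neg, ← fourier_add, sub_eq_add_neg]
  have id : ∀ k : ℤ, |k| ≤ B → (∑ q ∈ Finset.range L, ((w q : ℝ) : ℂ) * fourier k (θ q)) =
      ((max ((N:ℝ) - |(k:ℝ)|) 0 : ℝ) : ℂ) := by
    intro k hk
    rw [← count_fejer]
    have : ∀ q, ((w q : ℝ) : ℂ) * fourier k (θ q) = ∑ a ∈ Finset.range N, ∑ b ∈ Finset.range N,
        (1 / L) * (fourier ((a:ℤ) - b + k) (θ q) : ℂ) := by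
      intro q
      rw [hD]
      simp only [Finset.mul_sum, Finset.sum_mul, fourier_add, mul_assoc]
    simp only [this]
    rw [Finset.sum_comm]
    refine Finset.sum_congr rfl fun a ha => ?_
    rw [Finset.sum_comm]
    refine Finset.sum_congr rfl fun b hb => ?_
    rw [← Finset.mul_sum, root_sum L hL]
    · split_ifs
      · field_simp
      · simp
    · simp only [Finset.mem_range] at ha hb
      rw [abs_le] at hk
      rw [abs_lt]
      omega
  have h0 : ∑ q ∈ Finset.range L, w q = N := by
    have := id 0 (by simp)
    simp only [fourier_zero, mul_one, Int.cast_zero, abs_zero, sub_zero] at this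
    rw [max_eq_left (by positivity)] at this
    exact_mod_cast this
  have main := MB.sum hp (S := S) (Finset.range L) (m := fun q k => ((w q : ℝ) : ℂ) * fourier (k i) (θ q))
    (A := fun q => ‖((w q : ℝ) : ℂ)‖ * 1) (fun q _ => MB.smul _ (MB.trans i (θ q)))
  have hA : ∑ q ∈ Finset.range L, ‖((w q : ℝ) : ℂ)‖ * 1 = N := by
    rw [← h0]
    refine Finset.sum_congr rfl fun q _ => ?_
    rw [mul_one, Complex.norm_real, Real.norm_of_nonneg (hw0 q)]
  rw [hA] at main
  refine main.congr fun k hk => (id (k i) ?_).symm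
  have := hB k hk
  rw [Int.abs_eq_natAbs]; exact_mod_cast this


lemma polya_id (a : ℕ → ℝ) (L : ℕ) : ∀ m : ℕ, m ≤ L → a m =
    (∑ n ∈ Finset.range L, (a n - 2 * a (n + 1) + a (n + 2)) * max (((n + 1 : ℕ) : ℝ) - m) 0) +
      a L + (a L - a (L + 1)) * max ((L : ℝ) - m) 0 := by
  induction L with
  | zero => intro m hm; obtain rfl : m = 0 := by omega
            simp
  | succ L ih =>
    intro m hm
    rcases Nat.lt_or_ge m (L + 1) with h | h
    · have h' : (m:ℝ) ≤ L := by exact_mod_cast Nat.lt_succ_iff.1 h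
      rw [Finset.sum_range_succ]
      have := ih m (by omega)
      rw [max_eq_left (by linarith)] at this
      rw [max_eq_left (a := ((L + 1 : ℕ) : ℝ) - m) (by push_cast; linarith)]
      push_cast at this ⊢
      have e : L + 1 + 1 = L + 2 := rfl
      rw [e]
      linarith
    · obtain rfl : m = L + 1 := by omega
      rw [Finset.sum_eq_zero]
      · simp
      · intro n hn
        simp only [Finset.mem_range] at hn
        have : ((n + 1 : ℕ) : ℝ) ≤ ((L + 1 : ℕ) : ℝ) := by exact_mod_cast hn
        rw [max_eq_right (by linarith), mul_zero]

lemma MB.rsmul {m : (Fin d → ℤ) → ℂ} {A : ℝ} (r : ℝ) (hr : 0 ≤ r) (h : MB p S m A) :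
    MB p S (fun k => (r : ℂ) * m k) (r * A) := by
  have := h.smul (r : ℂ)
  rwa [Complex.norm_real, Real.norm_of_nonneg hr] at this

/-- Pólya's criterion: nonnegative, nonincreasing convex even sequences are good multipliers. -/
lemma MB.polya (hp : 1 ≤ p) (i : Fin d) (a : ℕ → ℝ) (h0 : ∀ n, 0 ≤ a n)
    (h1 : ∀ n, a (n + 1) ≤ a n) (h2 : ∀ n, a (n + 1) - a (n + 2) ≤ a n - a (n + 1)) :
    MB p S (fun k => ((a (k i).natAbs : ℝ) : ℂ)) (a 0) := by
  obtain ⟨L, hB⟩ : ∃ B : ℕ, ∀ k ∈ S, (k i).natAbs ≤ B :=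
    ⟨S.sup fun k => (k i).natAbs, fun k hk => Finset.le_sup (f := fun k => (k i).natAbs) hk⟩
  have t1 := MB.sum hp (S := S) (Finset.range L) (fun n _ =>
    MB.rsmul (a n - 2 * a (n + 1) + a (n + 2)) (by linarith [h2 n]) (MB.fejer hp i (n + 1)))
  have t2 := MB.rsmul (a L) (h0 L) (MB.one (p := p) (S := S))
  have t3 := MB.rsmul (a L - a (L + 1)) (by linarith [h1 L]) (MB.fejer (S := S) hp i L)
  have t := (t1.add hp t2).add hp t3
  have e0 := polya_id a L 0 (Nat.zero_le _)
  refine (t.mono (le_of_eq ?_)).congr ?_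
  · rw [e0]
    simp only [mul_one, Nat.cast_zero, sub_zero]
    rw [max_eq_left (by positivity)]
    congr 2
    refine Finset.sum_congr rfl fun n _ => ?_
    rw [max_eq_left (by positivity)]
  · intro k hk
    rw [polya_id a L _ (hB k hk)]
    have e : (((k i).natAbs : ℕ) : ℝ) = |(k i : ℝ)| := by
      rw [Nat.cast_natAbs]; simp
    rw [e]
    simp only [mul_one]
    rw [Complex.ofReal_add, Complex.ofReal_add, Complex.ofReal_sum, Complex.ofReal_mul]
    simp only [Complex.ofReal_mul]

section gauss
variable (q : ℝ)

def ga (n : ℕ) : ℝ := q ^ (n ^ 2)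
def gD (n : ℕ) : ℝ := ga q n - ga q (n + 1)
def gQ (n : ℕ) : Prop := 2 * q ^ (2 * n + 1) - q ^ 2 * (q ^ (2 * n + 1)) ^ 2 ≤ 1
def gb (M n : ℕ) : ℝ := if M ≤ n then ga q n else ga q M + ((M : ℝ) - n) * gD q M

variable {q}

lemma gD_eq (n : ℕ) : gD q n = q ^ (n ^ 2) * (1 - q ^ (2 * n + 1)) := by
  unfold gD ga; ring

lemma gD_nonneg (h0 : 0 < q) (h1 : q ≤ 1) (n : ℕ) : 0 ≤ gD q n := by
  rw [gD_eq]
  have : q ^ (2 * n + 1) ≤ 1 := pow_le_one₀ h0.le h1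
  have : 0 < q ^ (n ^ 2) := by positivity
  apply mul_nonneg this.le; linarith

lemma gD_diff (n : ℕ) : gD q n - gD q (n + 1) =
    q ^ (n ^ 2) * (1 - (2 * q ^ (2 * n + 1) - q ^ 2 * (q ^ (2 * n + 1)) ^ 2)) := by
  unfold gD ga; ring

lemma gD_anti (h0 : 0 < q) (n : ℕ) (h : gQ q n) : gD q (n + 1) ≤ gD q n := by
  have := gD_diff (q := q) n
  have h3 : 0 ≤ q ^ (n ^ 2) * (1 - (2 * q ^ (2 * n + 1) - q ^ 2 * (q ^ (2 * n + 1)) ^ 2)) :=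
    mul_nonneg (by positivity) (by unfold gQ at h; linarith)
  linarith

lemma gD_mono (h0 : 0 < q) (n : ℕ) (h : ¬ gQ q n) : gD q n ≤ gD q (n + 1) := by
  have := gD_diff (q := q) n
  have h3 : 0 ≤ q ^ (n ^ 2) * ((2 * q ^ (2 * n + 1) - q ^ 2 * (q ^ (2 * n + 1)) ^ 2) - 1) :=
    mul_nonneg (by positivity) (by unfold gQ at h; linarith)
  linarith

lemma gQ_succ (h0 : 0 < q) (h1 : q ≤ 1) (n : ℕ) (h : gQ q n) : gQ q (n + 1) := by
  unfold gQ at *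
  have e : q ^ (2 * (n + 1) + 1) = q ^ 2 * q ^ (2 * n + 1) := by ring
  rw [e]
  set y := q ^ (2 * n + 1)
  have hy0 : 0 < y := by positivity
  have hy1 : y ≤ 1 := pow_le_one₀ h0.le h1
  have hq : q ^ 2 ≤ 1 := pow_le_one₀ h0.le h1
  have hq0 : 0 < q ^ 2 := by positivity
  set r := q ^ 2
  have h3 : r * y ≤ y := by nlinarith
  have h4 : r * (y + r * y) ≤ 2 := by nlinarith
  nlinarith [mul_nonneg (sub_nonneg.2 h3) (sub_nonneg.2 h4)]

lemma gQ_le (h0 : 0 < q) (h1 : q ≤ 1) {M n : ℕ} (hMn : M ≤ n) (h : gQ q M) : gQ q n := by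
  induction n, hMn using Nat.le_induction with
  | base => exact h
  | succ n _ ih => exact gQ_succ h0 h1 n ih

lemma gb_diff (M n : ℕ) : gb q M n - gb q M (n + 1) = gD q (max M n) := by
  unfold gb
  rcases lt_trichotomy (n + 1) M with h | h | h
  · rw [if_neg (by omega), if_neg (by omega), max_eq_left (by omega)]
    push_cast; ring
  · subst h
    rw [if_neg (by omega), if_pos le_rfl, max_eq_left (by omega)]
    push_cast; ring
  · rw [if_pos (by omega), if_pos (by omega), max_eq_right (by omega)]; rfl

lemma gb_zero (M : ℕ) : gb q M 0 = ga q M + M * gD q M := by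
  unfold gb
  rcases Nat.eq_zero_or_pos M with rfl | h
  · simp
  · rw [if_neg (by omega)]; simp

lemma MB.tail (hp : 1 ≤ p) (i : Fin d) (h0 : 0 < q) (h1 : q ≤ 1) (M : ℕ) (h : gQ q M) :
    MB p S (fun k => ((gb q M (k i).natAbs : ℝ) : ℂ)) (gb q M 0) := by
  apply MB.polya hp i
  · intro n
    unfold gb
    have : ∀ n, 0 < ga q n := fun n => by unfold ga; positivity
    split_ifs with hh
    · exact (this n).le
    · have h3 : (n:ℝ) ≤ M := by exact_mod_cast (by omega : n ≤ M)
      exact add_nonneg (this M).le (mul_nonneg (by linarith) (gD_nonneg h0 h1 M))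
  · intro n
    have := gb_diff (q := q) M n
    linarith [gD_nonneg h0 h1 (max M n)]
  · intro n
    have e : n + 2 = n + 1 + 1 := rfl
    rw [e, gb_diff, gb_diff]
    rcases Nat.lt_or_ge n M with hh | hh
    · rw [max_eq_left (by omega), max_eq_left (by omega)]
    · rw [max_eq_right (by omega), max_eq_right (by omega)]
      exact gD_anti h0 n (gQ_le h0 h1 hh h)

lemma MB.near (hp : 1 ≤ p) (i : Fin d) (h0 : 0 < q) (M : ℕ)
    (h : ∀ n < M, ¬ gQ q n) :
    MB p S (fun k => ((gb q M (k i).natAbs - ga q (k i).natAbs : ℝ) : ℂ)) (gb q M 0 - ga q 0) := by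
  have hD : ∀ n, n ≤ M → gD q n ≤ gD q M := by
    intro n hn
    induction hn using Nat.decreasingInduction with
    | self => exact le_rfl
    | of_succ n hn ih => exact (gD_mono h0 n (h n hn)).trans ih
  have hd : ∀ n, gb q M n - ga q n - (gb q M (n + 1) - ga q (n + 1)) =
      gD q (max M n) - gD q n := by
    intro n
    rw [← gb_diff]; unfold gD; ring
  have hd0 : ∀ n, 0 ≤ gD q (max M n) - gD q n := by
    intro n
    rcases le_total M n with hh | hh
    · rw [max_eq_right hh]; simp
    · rw [max_eq_left hh]; linarith [hD n hh]
  apply MB.polya hp i (fun n => gb q M n - ga q n)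
  · intro n
    rcases le_total M n with hh | hh
    · simp [gb, hh]
    · induction hh using Nat.decreasingInduction with
      | self => simp [gb]
      | of_succ n hn ih =>
        linarith [hd n, hd0 n]
  · intro n
    linarith [hd n, hd0 n]
  · intro n
    have e : n + 2 = n + 1 + 1 := rfl
    rw [e, hd, hd]
    rcases Nat.lt_or_ge n M with hh | hh
    · rw [max_eq_left (by omega), max_eq_left (by omega)]
      linarith [gD_mono h0 n (h n hh)]
    · rw [max_eq_right (by omega), max_eq_right (by omega)]
      simp

lemma gQ_of (s : ℝ) (hs : 0 ≤ s) (hq : q = Real.exp (-s)) (n : ℕ) (h : 2 ≤ s * (2 * n + 1) ^ 2) :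
    gQ q n := by
  unfold gQ
  have h0 : 0 < q := hq ▸ Real.exp_pos _
  have h1 : q ≤ 1 := by rw [hq]; exact Real.exp_le_one_iff.2 (by linarith)
  set y := q ^ (2 * n + 1) with hy
  have hy0 : 0 < y := by positivity
  have e1 : 1 - 2 * s ≤ q ^ 2 := by
    rw [hq, ← Real.exp_nat_mul]
    have := Real.add_one_le_exp (((2:ℕ):ℝ) * -s)
    push_cast at *; linarith
  have e2 : y * (1 + s * (2 * n + 1)) ≤ 1 := by
    have : y = Real.exp (-(s * (2 * n + 1))) := by
      rw [hy, hq, ← Real.exp_nat_mul]; congr 1; push_cast; ring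
    have h3 := Real.add_one_le_exp (s * (2 * n + 1))
    calc y * (1 + s * (2 * n + 1)) ≤ y * Real.exp (s * (2 * n + 1)) := by
          gcongr; linarith
      _ = 1 := by rw [this, ← Real.exp_add]; simp
  have hx0 : 0 ≤ s * (2 * n + 1) := by positivity
  have hx : 2 * s ≤ (s * (2 * n + 1)) ^ 2 := by nlinarith
  set x := s * (2 * n + 1)
  have h4 : y * x ≤ 1 - y := by linarith
  have h5 : (y * x) ^ 2 ≤ (1 - y) ^ 2 := by gcongr
  have h6 : y ^ 2 * (1 - q ^ 2) ≤ y ^ 2 * x ^ 2 := by gcongr; linarith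
  nlinarith

lemma gb_zero_le (s : ℝ) (hq : q = Real.exp (-s)) (M : ℕ) :
    gb q M 0 ≤ Real.exp (-(s * M ^ 2)) * (1 + M * (2 * M + 1) * s) := by
  have ea : ga q M = Real.exp (-(s * M ^ 2)) := by
    unfold ga; rw [hq, ← Real.exp_nat_mul]; congr 1; push_cast; ring
  rw [gb_zero, gD_eq]
  change ga q M + M * (ga q M * _) ≤ _
  have : 1 - q ^ (2 * M + 1) ≤ (2 * M + 1) * s := by
    rw [hq, ← Real.exp_nat_mul]
    have := Real.add_one_le_exp (((2 * M + 1 : ℕ):ℝ) * -s)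
    push_cast at *; linarith
  have h2 : (0:ℝ) ≤ ga q M := by rw [ea]; positivity
  rw [← ea]
  calc _ ≤ ga q M + M * (ga q M * ((2 * M + 1) * s)) := by gcongr
    _ = _ := by ring

lemma MB.gauss (hp : 1 ≤ p) (i : Fin d) (s : ℝ) (hs : 0 ≤ s) (hq : q = Real.exp (-s)) :
    MB p S (fun k => ((ga q (k i).natAbs : ℝ) : ℂ)) 14 := by
  classical
  have h0 : 0 < q := hq ▸ Real.exp_pos _
  have h1 : q ≤ 1 := by rw [hq]; exact Real.exp_le_one_iff.2 (by linarith)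
  rcases hs.eq_or_lt with rfl | hs'
  · have : q = 1 := by rw [hq]; simp
    subst this
    simpa [ga] using (MB.one (p := p) (S := S)).mono (B := 14) (by norm_num)
  have ex : ∃ n, gQ q n := by
    obtain ⟨n, hn⟩ := exists_nat_gt (2 / s)
    refine ⟨n, gQ_of s hs hq n ?_⟩
    rw [div_lt_iff₀ hs'] at hn
    have : (n:ℝ) ≤ (2 * n + 1) ^ 2 := by nlinarith [(Nat.cast_nonneg n : (0:ℝ) ≤ n)]
    nlinarith
  set M := Nat.find ex
  have hM : gQ q M := Nat.find_spec ex
  have hM' : ∀ n < M, ¬ gQ q n := fun n hn => Nat.find_min ex hn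
  have t1 := MB.tail (S := S) hp i h0 h1 M hM
  have t2 := (MB.near (S := S) hp i h0 M hM').smul (-1)
  have t := t1.add hp t2
  have hb : gb q M 0 ≤ 7 := by
    refine (gb_zero_le s hq M).trans ?_
    have he : Real.exp (-(s * M ^ 2)) ≤ 1 := Real.exp_le_one_iff.2 (by simp; positivity)
    have : M * (2 * M + 1) * s ≤ 6 := by
      rcases Nat.eq_zero_or_pos M with h | h
      · rw [h]; simp
      · obtain ⟨n, hn⟩ : ∃ n, M = n + 1 := ⟨M - 1, by omega⟩
        have h5 : ¬ gQ q n := hM' n (by omega)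
        have h6 : s * (2 * n + 1) ^ 2 < 2 := by
          by_contra h7
          exact h5 (gQ_of s hs hq n (not_lt.1 h7))
        rw [hn]; push_cast
        have hn0 : (0:ℝ) ≤ n := Nat.cast_nonneg n
        have : ((n:ℝ) + 1) * (2 * (n + 1) + 1) ≤ 3 * (2 * n + 1) ^ 2 := by nlinarith
        nlinarith
    have h8 : 0 ≤ (M:ℝ) * (2 * M + 1) * s := by positivity
    nlinarith [Real.exp_pos (-(s * M ^ 2))]
  refine (t.mono ?_).congr ?_
  · have : ga q 0 = 1 := by simp [ga]
    simp only [norm_neg, norm_one, one_mul]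
    linarith
  · intro k _
    push_cast; ring

end gauss

def vp (M : ℕ) (n : ℕ) : ℝ :=
  2 * ((1 / (2 * M)) * max (((2 * M : ℕ) : ℝ) - n) 0) - (1 / M) * max ((M : ℝ) - n) 0

lemma vp_one (M n : ℕ) (hM : 0 < M) (h : n ≤ M) : vp M n = 1 := by
  have h1 : (n:ℝ) ≤ M := by exact_mod_cast h
  have h2 : (0:ℝ) < M := by exact_mod_cast hM
  unfold vp
  push_cast
  rw [max_eq_left (by linarith), max_eq_left (by linarith)]
  field_simp; ring

lemma vp_zero (M n : ℕ) (h : 2 * M ≤ n) : vp M n = 0 := by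
  have h1 : 2 * (M:ℝ) ≤ n := by exact_mod_cast h
  have h2 : (0:ℝ) ≤ M := Nat.cast_nonneg M
  unfold vp
  push_cast
  rw [max_eq_right (by linarith), max_eq_right (by linarith)]
  simp

lemma MB.vp (hp : 1 ≤ p) (i : Fin d) (M : ℕ) (hM : 0 < M) :
    MB p S (fun k => ((vp M (k i).natAbs : ℝ) : ℂ)) 3 := by
  have h2 : (0:ℝ) < M := by exact_mod_cast hM
  have t1 := MB.rsmul (1 / (2 * (M:ℝ))) (by positivity) (MB.fejer (S := S) hp i (2 * M))
  have t2 := (MB.rsmul (1 / (M:ℝ)) (by positivity) (MB.fejer (S := S) hp i M)).smul (-1)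
  have t := (MB.rsmul 2 (by norm_num) t1).add hp t2
  refine (t.mono ?_).congr ?_
  · simp only [norm_neg, norm_one]; push_cast; field_simp; norm_num
  · intro k _
    have e : (((k i).natAbs : ℕ) : ℝ) = |(k i : ℝ)| := by
      rw [Nat.cast_natAbs]; simp
    rw [Schauder.vp, e]
    push_cast; ring

lemma MB.vp' (hp : 1 ≤ p) (i : Fin d) (M : ℕ) (hM : 0 < M) :
    MB p S (fun k => 1 - ((Schauder.vp M (k i).natAbs : ℝ) : ℂ)) 4 := by
  have t := (MB.one (p := p) (S := S)).add hp ((MB.vp hp i M hM).smul (-1))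
  refine (t.mono ?_).congr ?_
  · simp only [norm_neg, norm_one]; norm_num
  · intro k _; ring


lemma MB.heat {q : ℝ} (hp : 1 ≤ p) (s : ℝ) (hs : 0 ≤ s) (hq : q = Real.exp (-s)) :
    MB p S (fun k => ∏ l, ((ga q (k l).natAbs : ℝ) : ℂ)) (14 ^ d) := by
  have := MB.prod (S := S) (p := p) Finset.univ (fun l _ => MB.gauss (S := S) hp l s hs hq)
  simpa using this

lemma MB.heat_tail {q : ℝ} (hp : 1 ≤ p) (s : ℝ) (hs : 0 ≤ s) (hq : q = Real.exp (-s)) (M : ℕ)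
    (hM : 0 < M) (hS : ∀ k ∈ S, ∃ i, 2 * M ≤ (k i).natAbs) (hQ : gQ q M) :
    MB p S (fun k => ∏ l, ((ga q (k l).natAbs : ℝ) : ℂ))
      (d * (4 * 3 ^ d * (gb q M 0 * 14 ^ d))) := by
  classical
  have h0 : 0 < q := hq ▸ Real.exp_pos _
  have h1 : q ≤ 1 := by rw [hq]; exact Real.exp_le_one_iff.2 (by linarith)
  have key : ∀ i : Fin d, MB p S (fun k => ((1 - ((Schauder.vp M (k i).natAbs : ℝ) : ℂ)) *
      ∏ l, (if l < i then ((Schauder.vp M (k l).natAbs : ℝ) : ℂ) else 1)) *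
      (((gb q M (k i).natAbs : ℝ) : ℂ) * ∏ l, (if l = i then 1 else ((ga q (k l).natAbs : ℝ) : ℂ))))
      (4 * 3 ^ d * (gb q M 0 * 14 ^ d)) := by
    intro i
    refine ((MB.vp' hp i M hM).mul ?_).mul ((MB.tail hp i h0 h1 M hQ).mul ?_)
    · have := MB.prod (S := S) (p := p) Finset.univ
        (m := fun l k => if l < i then ((Schauder.vp M (k l).natAbs : ℝ) : ℂ) else 1)
        (A := fun _ => 3) (fun l _ => by
          by_cases h : l < i
          · simpa [h] using MB.vp (S := S) hp l M hM
          · simpa [h] using (MB.one (p := p) (S := S)).mono (B := 3) (by norm_num))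
      simpa using this
    · have := MB.prod (S := S) (p := p) Finset.univ
        (m := fun l k => if l = i then 1 else ((ga q (k l).natAbs : ℝ) : ℂ))
        (A := fun _ => 14) (fun l _ => by
          by_cases h : l = i
          · simpa [h] using (MB.one (p := p) (S := S)).mono (B := 14) (by norm_num)
          · simpa [h] using MB.gauss (S := S) hp l s hs hq)
      simpa using this
  have t := MB.sum hp Finset.univ (fun i _ => key i)
  refine (t.mono (by simp)).congr ?_
  intro k hk
  obtain ⟨i₀, hi₀⟩ := hS k hk
  have e1 := Finset.prod_one_sub_ordered Finset.univ
    (fun l : Fin d => 1 - ((Schauder.vp M (k l).natAbs : ℝ) : ℂ))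
  rw [Finset.prod_eq_zero (Finset.mem_univ i₀) (by rw [vp_zero M _ hi₀]; simp)] at e1
  have e2 := (sub_eq_zero.1 e1.symm)
  refine ((one_mul _).symm.trans (congrArg (fun z => z * ∏ l, ((ga q (k l).natAbs : ℝ) : ℂ)) e2)).trans ?_
  simp only [Finset.sum_mul]
  refine Finset.sum_congr rfl fun i _ => ?_
  simp only [sub_sub_cancel, Finset.prod_filter]
  by_cases h : M ≤ (k i).natAbs
  · congr 1
    have : gb q M (k i).natAbs = ga q (k i).natAbs := by simp [gb, h]
    rw [this, ← Finset.mul_prod_erase _ _ (Finset.mem_univ i)]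
    congr 1
    rw [← Finset.mul_prod_erase Finset.univ (fun l => if l = i then 1 else _) (Finset.mem_univ i)]
    rw [if_pos rfl, one_mul]
    refine Finset.prod_congr rfl fun l hl => ?_
    rw [if_neg (Finset.ne_of_mem_erase hl)]
  · rw [vp_one M _ hM (by omega)]; simp

lemma MB.heat_decay (hp : 1 ≤ p) (s : ℝ) (hs : 0 ≤ s) (M : ℕ)
    (hM : 0 < M) (hS : ∀ k ∈ S, ∃ i, 2 * M ≤ (k i).natAbs) :
    MB p S (fun k => ∏ l, ((ga (Real.exp (-s)) (k l).natAbs : ℝ) : ℂ))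
      ((d * (4 * 3 ^ d * (11 * 14 ^ d)) + 2 * 14 ^ d) / (1 + s * M ^ 2)) := by
  set u := s * (M:ℝ) ^ 2 with hu
  have hu0 : 0 ≤ u := by positivity
  have hM1 : (1:ℝ) ≤ M := by exact_mod_cast hM
  rcases le_total u (1 / 2) with h | h
  · refine (MB.heat hp s hs rfl).mono ?_
    rw [le_div_iff₀ (by positivity)]
    have h3 : (0:ℝ) ≤ d * (4 * 3 ^ d * (11 * 14 ^ d)) := by positivity
    have h4 : (0:ℝ) < 14 ^ d := by positivity
    nlinarith
  · have hQ : gQ (Real.exp (-s)) M := by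
      refine gQ_of s hs rfl M ?_
      nlinarith
    refine (MB.heat_tail hp s hs rfl M hM hS hQ).mono ?_
    have hb : gb (Real.exp (-s)) M 0 * (1 + u) ≤ 11 := by
      have h1 := gb_zero_le s (q := Real.exp (-s)) rfl M
      rw [← hu] at h1
      have h2 : gb (Real.exp (-s)) M 0 ≤ Real.exp (-u) * (1 + 3 * u) := by
        refine h1.trans ?_
        refine mul_le_mul_of_nonneg_left ?_ (Real.exp_pos _).le
        have : s * M ≤ s * (M * M) := by gcongr; nlinarith
        nlinarith
      have h3 := Real.quadratic_le_exp_of_nonneg hu0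
      calc _ ≤ Real.exp (-u) * (1 + 3 * u) * (1 + u) := by gcongr
        _ = Real.exp (-u) * (1 + 4 * u + 3 * u ^ 2) := by ring
        _ ≤ Real.exp (-u) * (11 * Real.exp u) := by gcongr; nlinarith
        _ = 11 := by rw [mul_left_comm, ← Real.exp_add]; simp
    rw [le_div_iff₀ (by positivity)]
    calc _ = d * (4 * 3 ^ d * ((gb (Real.exp (-s)) M 0 * (1 + u)) * 14 ^ d)) := by ring
      _ ≤ d * (4 * 3 ^ d * (11 * 14 ^ d)) := by gcongr
      _ ≤ _ := by linarith [show (0:ℝ) ≤ 2 * 14 ^ d by positivity]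

lemma freqNorm_sq (k : Fin d → ℤ) : freqNorm k ^ 2 = ∑ i, (k i : ℝ) ^ 2 :=
  Real.sq_sqrt (Finset.sum_nonneg fun i _ => sq_nonneg _)

lemma heatCoef_eq (t : ℝ) (c : (Fin d → ℤ) → ℂ) (k : Fin d → ℤ) :
    heatCoef t c k =
      (∏ l, ((ga (Real.exp (-(4 * Real.pi ^ 2 * t))) (k l).natAbs : ℝ) : ℂ)) * c k := by
  unfold heatCoef
  congr 1
  have : ∀ n : ℤ, ga (Real.exp (-(4 * Real.pi ^ 2 * t))) n.natAbs =
      Real.exp (-(4 * Real.pi ^ 2 * t) * (n:ℝ) ^ 2) := by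
    intro n
    unfold ga
    rw [← Real.exp_nat_mul]
    congr 1
    push_cast
    have : ((n.natAbs : ℕ) : ℝ) ^ 2 = (n:ℝ) ^ 2 := by
      rw [Nat.cast_natAbs]; push_cast; exact sq_abs _
    rw [this]; ring
  simp only [this]
  rw [← Complex.ofReal_prod, ← Real.exp_sum, ← Finset.mul_sum, ← freqNorm_sq]
  push_cast
  congr 1; ring

lemma freq_le (k : Fin d → ℤ) (i : Fin d) : |(k i : ℝ)| ≤ freqNorm k := by
  refine Real.abs_le_sqrt ?_
  exact Finset.single_le_sum (f := fun i => (k i : ℝ) ^ 2) (fun i _ => sq_nonneg _)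
    (Finset.mem_univ i)

lemma rpow_le_one_add (x γ : ℝ) (hx : 0 ≤ x) (h0 : 0 ≤ γ) (h1 : γ ≤ 1) : x ^ γ ≤ 1 + x := by
  rcases le_total x 1 with h | h
  · linarith [Real.rpow_le_one hx h h0]
  · have := Real.rpow_le_rpow_of_exponent_le h h1
    rw [Real.rpow_one] at this; linarith

lemma block_bound (d : ℕ) (χ ρ : ℝ → ℝ)
    (hχsupp : ∀ ξ : ℝ, 4 / 3 ≤ |ξ| → χ ξ = 0)
    (hρsupp₁ : ∀ ξ : ℝ, |ξ| ≤ 3 / 4 → ρ ξ = 0)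
    (hρsupp₂ : ∀ ξ : ℝ, 8 / 3 ≤ |ξ| → ρ ξ = 0)
    (p : ENNReal) (hp : 1 ≤ p) (T : ℝ) (hT : 0 < T) :
    ∃ C : ℝ, 0 ≤ C ∧ ∀ c : (Fin d → ℤ) → ℂ, ∀ t ∈ Set.Icc (0 : ℝ) T, ∀ j : ℤ, -1 ≤ j →
      ENNReal.ofReal (1 + t * ((2:ℝ) ^ j) ^ 2) * eLpNorm (lpBlock χ ρ j (heatCoef t c)) p volume ≤
        ENNReal.ofReal C * eLpNorm (lpBlock χ ρ j c) p volume := by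
  classical
  set K : ℝ := d * (4 * 3 ^ d * (11 * 14 ^ d)) + 2 * 14 ^ d with hK
  have hK0 : 0 ≤ K := by positivity
  refine ⟨64 * (d + 1) ^ 2 * K + (1 + 16 * (d + 1) ^ 2 * T) * 14 ^ d, by positivity, ?_⟩
  intro c t ht j hj
  obtain ⟨ht0, htT⟩ := ht
  obtain ⟨B, hB⟩ := exists_nat_gt (4 * (2:ℝ) ^ j + 4)
  set S : Finset (Fin d → ℤ) := (Fintype.piFinset fun _ => Finset.Icc (-(B:ℤ)) B).filter
    (fun k => lpMult χ ρ j (freqNorm k) ≠ 0) with hSdef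
  have h2j : (0:ℝ) < 2 ^ j := by positivity
  have hS : ∀ k, k ∉ S → lpMult χ ρ j (freqNorm k) = 0 := by
    intro k hk
    by_contra hne
    apply hk
    have hf0 : 0 ≤ freqNorm k := Real.sqrt_nonneg _
    have hfB : freqNorm k ≤ B := by
      by_contra hlt
      apply hne
      unfold lpMult
      split_ifs
      · exact hχsupp _ (by rw [abs_of_nonneg hf0]; linarith)
      · refine hρsupp₂ _ ?_
        rw [abs_of_nonneg (by positivity), le_div_iff₀ h2j]; linarith
    simp only [hSdef, Finset.mem_filter, Fintype.mem_piFinset, Finset.mem_Icc]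
    refine ⟨fun i => ?_, hne⟩
    have := abs_le.1 ((freq_le k i).trans hfB)
    exact ⟨by exact_mod_cast this.1, by exact_mod_cast this.2⟩
  have hs : 0 ≤ 4 * Real.pi ^ 2 * t := by positivity
  set s := 4 * Real.pi ^ 2 * t with hsdef
  have hts : t ≤ s := by
    have h3 := Real.pi_gt_three
    have : 1 ≤ 4 * Real.pi ^ 2 := by nlinarith
    rw [hsdef]
    exact le_mul_of_one_le_left ht0 this
  obtain ⟨A, hA, hAC⟩ : ∃ A, MB p S (fun k => ∏ l, ((ga (Real.exp (-s)) (k l).natAbs : ℝ) : ℂ)) A ∧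
      (1 + t * ((2:ℝ) ^ j) ^ 2) * A ≤ 64 * (d + 1) ^ 2 * K + (1 + 16 * (d + 1) ^ 2 * T) * 14 ^ d := by
    have low : (2:ℝ) ^ j ≤ 4 * (d + 1) → ∃ A, MB p S (fun k => ∏ l, ((ga (Real.exp (-s)) (k l).natAbs : ℝ) : ℂ)) A ∧
      (1 + t * ((2:ℝ) ^ j) ^ 2) * A ≤ 64 * (d + 1) ^ 2 * K + (1 + 16 * (d + 1) ^ 2 * T) * 14 ^ d := by
      intro h
      refine ⟨14 ^ d, MB.heat hp s hs rfl, ?_⟩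
      calc (1 + t * ((2:ℝ) ^ j) ^ 2) * 14 ^ d ≤ (1 + T * (4 * (d + 1)) ^ 2) * 14 ^ d := by gcongr
        _ = (1 + 16 * (d + 1) ^ 2 * T) * 14 ^ d := by ring
        _ ≤ _ := by linarith [show (0:ℝ) ≤ 64 * (d + 1) ^ 2 * K by positivity]
    rcases hj.eq_or_lt with rfl | hj'
    · apply low
      have : (0:ℝ) ≤ d := Nat.cast_nonneg d
      norm_num; linarith
    obtain ⟨n, rfl⟩ := Int.eq_ofNat_of_zero_le (by omega : 0 ≤ j)
    simp only [zpow_natCast] at *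
    set M := 2 ^ n / (4 * (d + 1)) with hMdef
    have hdm := Nat.div_add_mod (2 ^ n) (4 * (d + 1))
    have hml := Nat.mod_lt (2 ^ n) (by omega : 4 * (d + 1) > 0)
    rw [← hMdef] at hdm
    rcases Nat.eq_zero_or_pos M with hM | hM
    · apply low
      rw [hM] at hdm
      have : 2 ^ n ≤ 4 * (d + 1) := by omega
      exact_mod_cast this
    refine ⟨_, MB.heat_decay hp s hs M hM ?_, ?_⟩
    · intro k hk
      by_contra! hcon
      have hne : lpMult χ ρ (n:ℤ) (freqNorm k) ≠ 0 := (Finset.mem_filter.1 hk).2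
      apply hne
      unfold lpMult
      rw [if_neg (by omega)]
      refine hρsupp₁ _ ?_
      have hf0 : 0 ≤ freqNorm k := Real.sqrt_nonneg _
      rw [abs_of_nonneg (by positivity), zpow_natCast, div_le_iff₀ (by positivity)]
      have hM2 : 4 * ((d:ℝ) + 1) * M ≤ 2 ^ n := by
        have : 4 * (d + 1) * M ≤ 2 ^ n := by omega
        exact_mod_cast this
      have hsq : freqNorm k ^ 2 ≤ d * (2 * M) ^ 2 := by
        rw [freqNorm_sq]
        have : ∀ i ∈ Finset.univ, (k i : ℝ) ^ 2 ≤ (2 * (M:ℝ)) ^ 2 := by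
          intro i _
          have h1 := (hcon i).le
          have h2 : (((k i).natAbs : ℕ) : ℝ) ≤ 2 * M := by exact_mod_cast h1
          have h3 : ((k i : ℝ)) ^ 2 = (((k i).natAbs : ℕ) : ℝ) ^ 2 := by
            rw [Nat.cast_natAbs]; push_cast; exact (sq_abs _).symm
          rw [h3]; gcongr
        simpa using Finset.sum_le_sum this
      have hd0 : (0:ℝ) ≤ d := Nat.cast_nonneg d
      have hM0 : (0:ℝ) ≤ M := Nat.cast_nonneg M
      have h5 : freqNorm k ^ 2 ≤ (3 / 4 * 2 ^ n) ^ 2 := by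
        calc freqNorm k ^ 2 ≤ d * (2 * M) ^ 2 := hsq
          _ ≤ (d + 1) ^ 2 * (2 * M) ^ 2 := by gcongr; nlinarith
          _ = (1 / 2 * (4 * ((d:ℝ) + 1) * M)) ^ 2 := by ring
          _ ≤ (3 / 4 * 2 ^ n) ^ 2 := by
            refine pow_le_pow_left₀ (by positivity) ?_ 2
            linarith [show (0:ℝ) < 2 ^ n by positivity]
      exact le_of_sq_le_sq h5 (by positivity)
    · rw [← hK]
      have hM1 : (1:ℝ) ≤ M := by exact_mod_cast hM
      have h6 : (2:ℝ) ^ n ≤ 8 * (d + 1) * M := by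
        have : 2 ^ n ≤ 8 * (d + 1) * M := by nlinarith
        exact_mod_cast this
      have h7 : 1 + t * ((2:ℝ) ^ n) ^ 2 ≤ 64 * (d + 1) ^ 2 * (1 + s * M ^ 2) := by
        calc 1 + t * ((2:ℝ) ^ n) ^ 2 ≤ 1 + s * (8 * (d + 1) * M) ^ 2 := by gcongr
          _ = 1 + 64 * (d + 1) ^ 2 * (s * M ^ 2) := by ring
          _ ≤ 64 * (d + 1) ^ 2 + 64 * (d + 1) ^ 2 * (s * M ^ 2) := by
            gcongr
            have : (0:ℝ) ≤ d := Nat.cast_nonneg d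
            nlinarith
          _ = _ := by ring
      calc (1 + t * ((2:ℝ) ^ n) ^ 2) * (K / (1 + s * M ^ 2))
          ≤ 64 * (d + 1) ^ 2 * (1 + s * M ^ 2) * (K / (1 + s * M ^ 2)) := by gcongr
        _ = 64 * (d + 1) ^ 2 * K := by
          have : 1 + s * (M:ℝ) ^ 2 ≠ 0 := by positivity
          field_simp
        _ ≤ _ := by linarith [show (0:ℝ) ≤ (1 + 16 * (d + 1) ^ 2 * T) * 14 ^ d by positivity]
  have hb : lpBlock χ ρ j (heatCoef t c) = fourierSeries (fun k =>
      (∏ l, ((ga (Real.exp (-s)) (k l).natAbs : ℝ) : ℂ)) *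
        (((lpMult χ ρ j (freqNorm k) : ℝ) : ℂ) * c k)) := by
    unfold lpBlock
    congr 1
    funext k
    rw [heatCoef_eq]; ring
  have := hA.2 (fun k => ((lpMult χ ρ j (freqNorm k) : ℝ) : ℂ) * c k)
    (fun k hk => by rw [hS k hk]; simp)
  rw [hb]
  calc _ ≤ ENNReal.ofReal (1 + t * ((2:ℝ) ^ j) ^ 2) * (ENNReal.ofReal A * eLpNorm (lpBlock χ ρ j c) p volume) := by
        gcongr; exact this
    _ = ENNReal.ofReal ((1 + t * ((2:ℝ) ^ j) ^ 2) * A) * eLpNorm (lpBlock χ ρ j c) p volume := by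
        rw [ENNReal.ofReal_mul (by positivity), mul_assoc]
    _ ≤ _ := by gcongr

end Schauder

/-- Schauder estimate for the periodic heat semigroup: for `α ∈ ℝ`, `β ∈ [0,2)`,
`p ∈ [1,∞]` and `T > 0`,
`sup_{0 ≤ t ≤ T} t^{β/2} ‖P_t f‖_{B^{α+β}_{p,∞}} ≲ ‖f‖_{B^α_{p,∞}}`. -/
theorem stmt15 (d : ℕ) (χ ρ : ℝ → ℝ)
    (hχ : ContDiff ℝ (⊤ : ℕ∞) χ) (hρ : ContDiff ℝ (⊤ : ℕ∞) ρ)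
    (hχsupp : ∀ ξ : ℝ, 4 / 3 ≤ |ξ| → χ ξ = 0)
    (hρsupp₁ : ∀ ξ : ℝ, |ξ| ≤ 3 / 4 → ρ ξ = 0)
    (hρsupp₂ : ∀ ξ : ℝ, 8 / 3 ≤ |ξ| → ρ ξ = 0)
    (hsum : ∀ ξ : ℝ, χ ξ + (∑' j : ℕ, ρ (ξ / (2 : ℝ) ^ j)) = 1)
    (α β : ℝ) (hβ0 : 0 ≤ β) (hβ2 : β < 2)
    (p : ENNReal) (hp : 1 ≤ p) (T : ℝ) (hT : 0 < T) :
    ∃ C : ENNReal, C ≠ ⊤ ∧ ∀ c : (Fin d → ℤ) → ℂ, ∀ t ∈ Set.Icc (0 : ℝ) T,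
      ENNReal.ofReal (Real.rpow t (β / 2)) *
          besovNorm χ ρ (α + β) p (heatCoef t c) ≤
        C * besovNorm χ ρ α p c := by
  obtain ⟨C, hC0, hC⟩ := Schauder.block_bound d χ ρ hχsupp hρsupp₁ hρsupp₂ p hp T hT
  refine ⟨ENNReal.ofReal C, ENNReal.ofReal_ne_top, ?_⟩
  intro c t ht
  have ht0 : 0 ≤ t := ht.1
  unfold besovNorm
  rw [ENNReal.mul_iSup]
  refine iSup_le fun j => ?_
  rw [ENNReal.mul_iSup]
  refine iSup_le fun hj => ?_
  refine le_trans ?_ (mul_le_mul_right (le_iSup₂ (f := fun (j : ℤ) (_ : -1 ≤ j) =>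
    ENNReal.ofReal (Real.rpow 2 (α * (j : ℝ))) * eLpNorm (lpBlock χ ρ j c) p volume) j hj) _)
  have h2j : (0:ℝ) < 2 ^ j := by positivity
  have key : Real.rpow t (β / 2) * Real.rpow 2 ((α + β) * j) ≤
      Real.rpow 2 (α * j) * (1 + t * ((2:ℝ) ^ j) ^ 2) := by
    change t ^ (β / 2) * (2:ℝ) ^ ((α + β) * (j:ℝ)) ≤ (2:ℝ) ^ (α * (j:ℝ)) * _
    have e1 : (2:ℝ) ^ ((α + β) * (j:ℝ)) = (2:ℝ) ^ (α * (j:ℝ)) * (((2:ℝ) ^ j) ^ 2) ^ (β / 2) := by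
      rw [add_mul, Real.rpow_add (by norm_num)]
      congr 1
      rw [← Real.rpow_natCast, ← Real.rpow_intCast, ← Real.rpow_mul (by positivity),
        ← Real.rpow_mul (by positivity)]
      congr 1
      push_cast; ring
    rw [e1, mul_left_comm, ← Real.mul_rpow ht0 (by positivity)]
    gcongr
    exact Schauder.rpow_le_one_add _ _ (by positivity) (by linarith) (by linarith)
  calc _ = ENNReal.ofReal (Real.rpow t (β / 2) * Real.rpow 2 ((α + β) * j)) *
        eLpNorm (lpBlock χ ρ j (heatCoef t c)) p volume := by
        rw [ENNReal.ofReal_mul (show 0 ≤ Real.rpow t (β / 2) from Real.rpow_nonneg ht0 _), mul_assoc]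
    _ ≤ ENNReal.ofReal (Real.rpow 2 (α * j) * (1 + t * ((2:ℝ) ^ j) ^ 2)) *
        eLpNorm (lpBlock χ ρ j (heatCoef t c)) p volume := by gcongr
    _ = ENNReal.ofReal (Real.rpow 2 (α * j)) * (ENNReal.ofReal (1 + t * ((2:ℝ) ^ j) ^ 2) *
        eLpNorm (lpBlock χ ρ j (heatCoef t c)) p volume) := by
        rw [ENNReal.ofReal_mul (show 0 ≤ Real.rpow 2 (α * j) from Real.rpow_nonneg (by norm_num) _), mul_assoc]
    _ ≤ ENNReal.ofReal (Real.rpow 2 (α * j)) *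
        (ENNReal.ofReal C * eLpNorm (lpBlock χ ρ j c) p volume) := by
        exact mul_le_mul_right (hC c t ht j hj) _
    _ = _ := by ring
end
end

section
/- For a centered Gaussian vector (X, Y_n) in ℝ^{2m} with the law of X and of Y_n fixed, if all cross-covariances Cov(X_i, Y_n^j) → 0 as n → ∞, then for all Borel sets A, B ⊆ ℝ^m, P(X ∈ A, Y_n ∈ B) → P(X ∈ A) P(Y ∈ B), where Y has the common law of the Y_n. -/
noncomputable section
open MeasureTheory Filter

lemma gauss_aux {Ω : Type*} [MeasurableSpace Ω] (P : Measure Ω) [IsProbabilityMeasure P]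
    (L : Ω → ℝ) (hL : Measurable L) (v : NNReal)
    (h : P.map L = ProbabilityTheory.gaussianReal 0 v) :
    MemLp L 2 P ∧ ∫ ω, Complex.exp (L ω * Complex.I) ∂P
      = Complex.exp (((-(∫ ω, L ω ^ 2 ∂P) / 2 : ℝ)) : ℂ) := by
  have h2 : MemLp id 2 (P.map L) := by
    rw [h]; exact ProbabilityTheory.memLp_id_gaussianReal' 2 (by simp)
  have hm : MemLp L 2 P := by
    have := (memLp_map_measure_iff (by fun_prop) hL.aemeasurable).1 h2
    simpa using this
  refine ⟨hm, ?_⟩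
  have hv : ∫ ω, L ω ^ 2 ∂P = v := by
    have e : ∫ x, x ^ 2 ∂(P.map L) = ∫ ω, L ω ^ 2 ∂P :=
      integral_map hL.aemeasurable (by fun_prop)
    rw [← e, h]
    have := ProbabilityTheory.variance_fun_id_gaussianReal (μ := 0) (v := v)
    rw [ProbabilityTheory.variance_eq_integral (by fun_prop)] at this
    simpa using this
  have hc := ProbabilityTheory.charFun_gaussianReal (μ := 0) (v := v) 1
  rw [← h, charFun_apply_real, integral_map hL.aemeasurable (by fun_prop)] at hc
  rw [hv]
  simp only [Complex.ofReal_one, one_mul] at hc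
  rw [hc]
  congr 1
  push_cast
  ring

/-- Pass from open rectangles to all Borel rectangles. -/
lemma borel_aux {Ω : Type*} [MeasurableSpace Ω] (P : Measure Ω)
    [IsProbabilityMeasure P] (m : ℕ)
    (X : Ω → (Fin m → ℝ)) (Y : ℕ → Ω → (Fin m → ℝ))
    (hXm : Measurable X) (hYm : ∀ n, Measurable (Y n))
    (hYlaw : ∀ n, P.map (Y n) = P.map (Y 0))
    (hopen : ∀ U V : Set (Fin m → ℝ), IsOpen U → IsOpen V → ∀ ε > 0, ∀ᶠ n in atTop,
      P.real (X ⁻¹' U) * P.real (Y 0 ⁻¹' V) - ε ≤ P.real (X ⁻¹' U ∩ Y n ⁻¹' V)) :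
    ∀ A B : Set (Fin m → ℝ), MeasurableSet A → MeasurableSet B →
      Tendsto (fun n : ℕ => P (X ⁻¹' A ∩ Y n ⁻¹' B)) atTop
        (nhds (P (X ⁻¹' A) * P (Y 0 ⁻¹' B))) := by
  have hYr : ∀ n (B : Set (Fin m → ℝ)), MeasurableSet B →
      P.real (Y n ⁻¹' B) = P.real (Y 0 ⁻¹' B) := by
    intro n B hB
    rw [← map_measureReal_apply (hYm n) hB, hYlaw, map_measureReal_apply (hYm 0) hB]
  have happ : ∀ (Z : Ω → (Fin m → ℝ)), Measurable Z → ∀ A, MeasurableSet A → ∀ ε > 0,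
      ∃ U, A ⊆ U ∧ IsOpen U ∧ P.real (Z ⁻¹' U) ≤ P.real (Z ⁻¹' A) + ε := by
    intro Z hZ A hA ε hε
    have := Measure.isProbabilityMeasure_map (μ := P) hZ.aemeasurable
    obtain ⟨U, hAU, hU, hlt⟩ := A.exists_isOpen_lt_add (μ := P.map Z) (measure_ne_top _ _)
      (ε := ENNReal.ofReal ε) (by simpa using hε)
    refine ⟨U, hAU, hU, ?_⟩
    rw [Measure.map_apply hZ hA, Measure.map_apply hZ hU.measurableSet] at hlt
    have h2 := ENNReal.toReal_mono (by finiteness) hlt.le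
    rwa [ENNReal.toReal_add (by finiteness) (by finiteness), ENNReal.toReal_ofReal hε.le] at h2
  have hlow : ∀ A B : Set (Fin m → ℝ), MeasurableSet A → MeasurableSet B → ∀ ε > 0,
      ∀ᶠ n in atTop,
      P.real (X ⁻¹' A) * P.real (Y 0 ⁻¹' B) - ε ≤ P.real (X ⁻¹' A ∩ Y n ⁻¹' B) := by
    intro A B hA hB ε hε
    obtain ⟨U, hAU, hU, hU'⟩ := happ X hXm A hA (ε / 3) (by positivity)
    obtain ⟨V, hBV, hV, hV'⟩ := happ (Y 0) (hYm 0) B hB (ε / 3) (by positivity)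
    filter_upwards [hopen U V hU hV (ε / 3) (by positivity)] with n hn
    have e1 : P.real (X ⁻¹' A) * P.real (Y 0 ⁻¹' B) ≤ P.real (X ⁻¹' U) * P.real (Y 0 ⁻¹' V) :=
      mul_le_mul (measureReal_mono (Set.preimage_mono hAU))
        (measureReal_mono (Set.preimage_mono hBV)) measureReal_nonneg measureReal_nonneg
    have e2 : P.real (X ⁻¹' U ∩ Y n ⁻¹' V) ≤ P.real (X ⁻¹' A ∩ Y n ⁻¹' B)
        + P.real (X ⁻¹' U \ X ⁻¹' A) + P.real (Y n ⁻¹' V \ Y n ⁻¹' B) := by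
      refine (measureReal_mono (s₂ := ((X ⁻¹' A ∩ Y n ⁻¹' B) ∪ (X ⁻¹' U \ X ⁻¹' A)) ∪
        (Y n ⁻¹' V \ Y n ⁻¹' B)) ?_).trans ?_
      · intro ω hω
        simp only [Set.mem_union, Set.mem_inter_iff, Set.mem_sdiff] at hω ⊢
        tauto
      · refine (measureReal_union_le _ _).trans ?_
        gcongr
        exact measureReal_union_le _ _
    have e3 := measureReal_sdiff (μ := P) (Set.preimage_mono (f := X) hAU) (hXm hA)
    have e4 := measureReal_sdiff (μ := P) (Set.preimage_mono (f := Y n) hBV) (hYm n hB)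
    rw [hYr n _ hB, hYr n _ hV.measurableSet] at e4
    linarith
  intro A B hA hB
  have hreal : Tendsto (fun n : ℕ => P.real (X ⁻¹' A ∩ Y n ⁻¹' B)) atTop
        (nhds (P.real (X ⁻¹' A) * P.real (Y 0 ⁻¹' B))) := by
    rw [Metric.tendsto_nhds]
    intro ε hε
    filter_upwards [hlow A B hA hB (ε / 2) (by positivity),
      hlow A Bᶜ hA hB.compl (ε / 2) (by positivity)] with n h1 h2
    rw [Set.preimage_compl, Set.preimage_compl, probReal_compl_eq_one_sub (hYm 0 hB),
      ← Set.sdiff_eq] at h2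
    have h3 := measureReal_inter_add_sdiff (μ := P) (s := X ⁻¹' A) (hYm n hB)
    rw [Real.dist_eq, abs_lt]
    constructor <;> nlinarith
  rw [← ENNReal.tendsto_toReal_iff (by intro; finiteness) (by finiteness), ENNReal.toReal_mul]
  exact hreal

/-- Glue two vectors into one Euclidean vector. -/
def glue {m : ℕ} (p : (Fin m → ℝ) × (Fin m → ℝ)) : EuclideanSpace ℝ (Fin m ⊕ Fin m) :=
  WithLp.toLp 2 (Sum.elim p.1 p.2)

lemma glue_meas {m : ℕ} : Measurable (glue (m := m)) := by
  have h : Measurable (fun p : (Fin m → ℝ) × (Fin m → ℝ) =>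
      (Sum.elim p.1 p.2 : Fin m ⊕ Fin m → ℝ)) := by
    refine measurable_pi_iff.2 ?_
    rintro (i | i) <;> simp <;> fun_prop
  exact (WithLp.measurable_toLp 2 _).comp h

lemma glue_inner {m : ℕ} (p : (Fin m → ℝ) × (Fin m → ℝ))
    (t : EuclideanSpace ℝ (Fin m ⊕ Fin m)) :
    inner ℝ (glue p) t = (∑ i, t (Sum.inl i) * p.1 i) + ∑ i, t (Sum.inr i) * p.2 i := by
  simp [glue, PiLp.inner_apply, Fintype.sum_sum_type]

/-- Finite-dimensional mixing criterion for Gaussian vectors: if `(X, Y_n)` are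
jointly Gaussian centered vectors in `ℝ^m` with the laws of `X` and of the
`Y_n` fixed, and all cross-covariances tend to `0`, then
`P(X ∈ A, Y_n ∈ B) → P(X ∈ A) P(Y ∈ B)`. -/
theorem stmt17 {Ω : Type*} [MeasurableSpace Ω] (P : Measure Ω)
    [IsProbabilityMeasure P] (m : ℕ)
    (X : Ω → (Fin m → ℝ)) (Y : ℕ → Ω → (Fin m → ℝ))
    (hXm : Measurable X) (hYm : ∀ n, Measurable (Y n))
    (hGauss : ∀ (n : ℕ) (a b : Fin m → ℝ), ∃ v : NNReal,
      P.map (fun ω => (∑ i, a i * X ω i) + ∑ i, b i * Y n ω i) =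
        ProbabilityTheory.gaussianReal 0 v)
    (hYlaw : ∀ n, P.map (Y n) = P.map (Y 0))
    (hcov : ∀ i j : Fin m,
      Tendsto (fun n : ℕ => ∫ ω, X ω i * Y n ω j ∂P) atTop (nhds 0)) :
    ∀ A B : Set (Fin m → ℝ), MeasurableSet A → MeasurableSet B →
      Tendsto (fun n : ℕ => P (X ⁻¹' A ∩ Y n ⁻¹' B)) atTop
        (nhds (P (X ⁻¹' A) * P (Y 0 ⁻¹' B))) := by
  have hlin : ∀ a : Fin m → ℝ, Measurable (fun x : Fin m → ℝ => ∑ i, a i * x i) := by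
    intro a; fun_prop
  have hX : ∀ a : Fin m → ℝ, ∃ v, P.map (fun ω => ∑ i, a i * X ω i) =
      ProbabilityTheory.gaussianReal 0 v := by
    intro a; simpa using hGauss 0 a 0
  have hY : ∀ n (a : Fin m → ℝ), ∃ v, P.map (fun ω => ∑ i, a i * Y n ω i) =
      ProbabilityTheory.gaussianReal 0 v := by
    intro n a; simpa using hGauss n 0 a
  have hX2 : ∀ i, MemLp (fun ω => X ω i) 2 P := by
    intro i
    obtain ⟨v, hv⟩ := hX (Pi.single i 1)
    simpa [Pi.single_apply, Function.comp_def] using (gauss_aux P _ ((hlin _).comp hXm) v hv).1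
  have hY2 : ∀ n i, MemLp (fun ω => Y n ω i) 2 P := by
    intro n i
    obtain ⟨v, hv⟩ := hY n (Pi.single i 1)
    simpa [Pi.single_apply, Function.comp_def] using (gauss_aux P _ ((hlin _).comp (hYm n)) v hv).1
  -- the characteristic functions converge
  have hchar : ∀ a b : Fin m → ℝ, Tendsto (fun n => ∫ ω, Complex.exp
      ((((∑ i, a i * X ω i) + ∑ i, b i * Y n ω i : ℝ) : ℂ) * Complex.I) ∂P) atTop
      (nhds ((∫ ω, Complex.exp (((∑ i, a i * X ω i : ℝ) : ℂ) * Complex.I) ∂P) *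
        ∫ ω, Complex.exp (((∑ i, b i * Y 0 ω i : ℝ) : ℂ) * Complex.I) ∂P)) := by
    intro a b
    have mX : Measurable (fun ω => ∑ i, a i * X ω i) := (hlin a).comp hXm
    have mY : ∀ n, Measurable (fun ω => ∑ i, b i * Y n ω i) := fun n => (hlin b).comp (hYm n)
    obtain ⟨v, hv⟩ := hX a
    obtain ⟨w, hw⟩ := hY 0 b
    obtain ⟨LX, eX⟩ := gauss_aux P _ mX v hv
    obtain ⟨LY, eY⟩ := gauss_aux P _ (mY 0) w hw
    have LYn : ∀ n, MemLp (fun ω => ∑ i, b i * Y n ω i) 2 P := fun n => by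
      obtain ⟨u, hu⟩ := hY n b
      exact (gauss_aux P _ (mY n) u hu).1
    have eq : ∀ n, ∫ ω, (∑ i, b i * Y n ω i) ^ 2 ∂P = ∫ ω, (∑ i, b i * Y 0 ω i) ^ 2 ∂P := by
      intro n
      have h1 : ∀ n, ∫ x, (∑ i, b i * x i) ^ 2 ∂(P.map (Y n)) =
          ∫ ω, (∑ i, b i * Y n ω i) ^ 2 ∂P := fun n =>
        integral_map (hYm n).aemeasurable ((hlin b).pow_const 2).aestronglyMeasurable
      rw [← h1, ← h1, hYlaw]
    have ec : ∀ n, ∫ ω, (∑ i, a i * X ω i) * (∑ i, b i * Y n ω i) ∂P =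
        ∑ i, ∑ j, a i * b j * ∫ ω, X ω i * Y n ω j ∂P := by
      intro n
      have hint : ∀ i j, Integrable (fun ω => a i * b j * (X ω i * Y n ω j)) P := fun i j =>
        ((hX2 i).integrable_mul (hY2 n j)).const_mul _
      simp_rw [Finset.sum_mul_sum, ← integral_const_mul]
      rw [integral_finsetSum _ (fun i _ => ?_)]
      · refine Finset.sum_congr rfl fun i _ => ?_
        rw [integral_finsetSum _ (fun j _ => ?_)]
        · refine Finset.sum_congr rfl fun j _ => ?_
          congr 1; ext ω; ring
        · exact (hint i j).congr (ae_of_all _ fun ω => by ring)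
      · exact integrable_finsetSum _ fun j _ =>
          (hint i j).congr (ae_of_all _ fun ω => by ring)
    have tc : Tendsto (fun n => ∫ ω, (∑ i, a i * X ω i) * (∑ i, b i * Y n ω i) ∂P) atTop
        (nhds 0) := by
      simp_rw [ec]
      have := tendsto_finsetSum (Finset.univ : Finset (Fin m)) (fun i _ =>
        tendsto_finsetSum (Finset.univ : Finset (Fin m)) (fun j _ =>
          (hcov i j).const_mul (a i * b j)))
      simpa using this
    have e2 : ∀ n, ∫ ω, ((∑ i, a i * X ω i) + ∑ i, b i * Y n ω i) ^ 2 ∂P =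
        ∫ ω, (∑ i, a i * X ω i) ^ 2 ∂P +
          2 * (∫ ω, (∑ i, a i * X ω i) * (∑ i, b i * Y n ω i) ∂P) +
        ∫ ω, (∑ i, b i * Y 0 ω i) ^ 2 ∂P := by
      intro n
      rw [← eq n, ← integral_const_mul, ← integral_add, ← integral_add]
      · congr 1; ext ω; ring
      · exact LX.integrable_sq.add ((LX.integrable_mul (LYn n)).const_mul 2)
      · exact (LYn n).integrable_sq
      · exact LX.integrable_sq
      · exact (LX.integrable_mul (LYn n)).const_mul 2
    have e3 : ∀ n, ∫ ω, Complex.exp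
        ((((∑ i, a i * X ω i) + ∑ i, b i * Y n ω i : ℝ) : ℂ) * Complex.I) ∂P = _ := fun n =>
      (gauss_aux P _ (mX.add (mY n)) _ (hGauss n a b).choose_spec).2
    simp_rw [e3]
    rw [eX, eY, ← Complex.exp_add, ← Complex.ofReal_add]
    simp_rw [Pi.add_apply, e2]
    have hcont : Continuous (fun x : ℝ => Complex.exp (x : ℂ)) := by fun_prop
    refine (hcont.tendsto _).comp ?_
    have := ((tc.const_mul 2).const_add (∫ ω, (∑ i, a i * X ω i) ^ 2 ∂P)).add_const
      (∫ ω, (∑ i, b i * Y 0 ω i) ^ 2 ∂P)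
    convert (this.neg.div_const 2) using 2
    ring
  -- weak convergence
  have pX := Measure.isProbabilityMeasure_map (μ := P) hXm.aemeasurable
  have pY := Measure.isProbabilityMeasure_map (μ := P) (hYm 0).aemeasurable
  have mZ : ∀ n, Measurable (fun ω => glue (X ω, Y n ω)) := fun n =>
    glue_meas.comp (hXm.prodMk (hYm n))
  let μs : ℕ → ProbabilityMeasure (EuclideanSpace ℝ (Fin m ⊕ Fin m)) := fun n =>
    ⟨P.map (fun ω => glue (X ω, Y n ω)),
      Measure.isProbabilityMeasure_map (mZ n).aemeasurable⟩
  let μ0 : ProbabilityMeasure (EuclideanSpace ℝ (Fin m ⊕ Fin m)) :=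
    ⟨((P.map X).prod (P.map (Y 0))).map glue,
      Measure.isProbabilityMeasure_map glue_meas.aemeasurable⟩
  have hweak : Tendsto μs atTop (nhds μ0) := by
    refine ProbabilityMeasure.tendsto_of_tendsto_charFun fun t => ?_
    convert hchar (fun i => t (Sum.inl i)) (fun i => t (Sum.inr i)) using 2 with n
    · change charFun (P.map (fun ω => glue (X ω, Y n ω))) t = _
      rw [charFun_apply, integral_map (mZ n).aemeasurable
        (by fun_prop)]
      simp_rw [glue_inner]
    · change charFun (((P.map X).prod (P.map (Y 0))).map glue) t = _
      rw [charFun_apply, integral_map glue_meas.aemeasurable (by fun_prop)]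
      simp_rw [glue_inner, Complex.ofReal_add, add_mul, Complex.exp_add]
      rw [integral_prod_mul
        (fun x : Fin m → ℝ => Complex.exp (((∑ i, t (Sum.inl i) * x i : ℝ) : ℂ) * Complex.I))
        (fun x : Fin m → ℝ => Complex.exp (((∑ i, t (Sum.inr i) * x i : ℝ) : ℂ) * Complex.I)),
        integral_map hXm.aemeasurable (by apply Measurable.aestronglyMeasurable; fun_prop),
        integral_map (hYm 0).aemeasurable (by apply Measurable.aestronglyMeasurable; fun_prop)]
  refine borel_aux P m X Y hXm hYm hYlaw ?_
  intro U V hU hV ε hε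
  let G : Set (EuclideanSpace ℝ (Fin m ⊕ Fin m)) :=
    {z | (fun i => z (Sum.inl i)) ∈ U ∧ (fun i => z (Sum.inr i)) ∈ V}
  have hG : IsOpen G :=
    (hU.preimage (f := fun (z : EuclideanSpace ℝ (Fin m ⊕ Fin m)) i => z (Sum.inl i))
      (by fun_prop)).inter
    (hV.preimage (f := fun (z : EuclideanSpace ℝ (Fin m ⊕ Fin m)) i => z (Sum.inr i))
      (by fun_prop))
  have g0 : (μ0 : Measure _) G = P (X ⁻¹' U) * P (Y 0 ⁻¹' V) := by
    change (((P.map X).prod (P.map (Y 0))).map glue) G = _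
    rw [Measure.map_apply glue_meas hG.measurableSet]
    have : glue ⁻¹' G = U ×ˢ V := by
      ext p; simp [glue, G]
    rw [this, Measure.prod_prod, Measure.map_apply hXm hU.measurableSet,
      Measure.map_apply (hYm 0) hV.measurableSet]
  have gn : ∀ n, (μs n : Measure _) G = P (X ⁻¹' U ∩ Y n ⁻¹' V) := by
    intro n
    change (P.map (fun ω => glue (X ω, Y n ω))) G = _
    rw [Measure.map_apply (mZ n) hG.measurableSet]
    congr 1
  have hlim := ProbabilityMeasure.le_liminf_measure_open_of_tendsto hweak hG
  simp_rw [g0, gn] at hlim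
  by_cases hneg : P.real (X ⁻¹' U) * P.real (Y 0 ⁻¹' V) - ε < 0
  · exact Eventually.of_forall fun n => hneg.le.trans measureReal_nonneg
  · have hlt : ENNReal.ofReal (P.real (X ⁻¹' U) * P.real (Y 0 ⁻¹' V) - ε) <
        P (X ⁻¹' U) * P (Y 0 ⁻¹' V) := by
      rw [ENNReal.ofReal_lt_iff_lt_toReal (not_lt.1 hneg) (by finiteness), ENNReal.toReal_mul]
      exact sub_lt_self _ hε
    filter_upwards [eventually_lt_of_lt_liminf (hlt.trans_le hlim)] with n hn
    exact (ENNReal.ofReal_le_iff_le_toReal (by finiteness)).1 hn.le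
end
end
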